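/- Fix N ≥ 1, β ∈ (0,1] and a non-negative function f on (Σ_N²)^n. Then for all t, s ∈ [0,1], E⟨f⟩_{t,s} ≤ exp(2(2n² + 1)·β²·(1 + t))·E⟨f⟩_{t,1}, where ⟨·⟩_{t,1} = ⟨·⟩_t is the coupled Gibbs average of the full N-spin system. -/

import Mathlib

open MeasureTheory ProbabilityTheory Real Finset Filter

noncomputable section

/-- Spin configurations: each of the `N` sites carries a `±1` spin, encoded by a `Bool`. -/
abbrev Config (N : ℕ) := Fin N → Bool

/-- The `±1` value of a spin. -/
def spin (b : Bool) : ℝ := if b then 1 else -1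

/-- The value of the last spin `σ_N` (junk value `0` when `N = 0`). -/
def spinLast {N : ℕ} (σ : Config N) : ℝ :=
  if h : 0 < N then spin (σ ⟨N - 1, Nat.sub_lt h Nat.one_pos⟩) else 0

/-- The Gaussian disorder: i.i.d. standard Gaussians indexed by pairs `(i, j)`
(only the entries with `i < j` are used). -/
def gaussPi (N : ℕ) : Measure (Fin N × Fin N → ℝ) :=
  Measure.pi fun _ => gaussianReal 0 1

instance (N : ℕ) : IsProbabilityMeasure (gaussPi N) := by
  unfold gaussPi; infer_instance

/-- Three independent copies `g, g', g''` of the disorder. -/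
def disM3 (N : ℕ) :
    Measure ((Fin N × Fin N → ℝ) × (Fin N × Fin N → ℝ) × (Fin N × Fin N → ℝ)) :=
  (gaussPi N).prod ((gaussPi N).prod (gaussPi N))

/-- The SK Hamiltonian `H_{N,β}(σ) = (β/√N) ∑_{i<j} g_{ij} σ_i σ_j`. -/
def ham (N : ℕ) (β : ℝ) (g : Fin N × Fin N → ℝ) (σ : Config N) : ℝ :=
  (β / Real.sqrt N) *
    ∑ p ∈ Finset.univ.filter (fun p : Fin N × Fin N => p.1 < p.2),
      g p * spin (σ p.1) * spin (σ p.2)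

/-- The cavity Hamiltonian `H⁻_N(σ) = (β/√N) ∑_{i<j<N} g_{ij} σ_i σ_j` on the first
`N - 1` spins. -/
def hamCav (N : ℕ) (β : ℝ) (g : Fin N × Fin N → ℝ) (σ : Config N) : ℝ :=
  (β / Real.sqrt N) *
    ∑ p ∈ Finset.univ.filter
        (fun p : Fin N × Fin N => p.1 < p.2 ∧ (p.2 : ℕ) < N - 1),
      g p * spin (σ p.1) * spin (σ p.2)

/-- The overlap `R(σ¹,σ²) = (1/N) ∑_{i ≤ N} σ_i¹ σ_i²`. -/
def ovlp (N : ℕ) (σ τ : Config N) : ℝ := (∑ i, spin (σ i) * spin (τ i)) / N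

/-- The truncated overlap `R⁻(σ¹,σ²) = (1/N) ∑_{i ≤ N−1} σ_i¹ σ_i²`. -/
def ovlpm (N : ℕ) (σ τ : Config N) : ℝ :=
  (∑ i ∈ Finset.univ.filter (fun i : Fin N => (i : ℕ) < N - 1),
    spin (σ i) * spin (τ i)) / N

/-- The partition function `Z_N(β)`. -/
def partFun (N : ℕ) (β : ℝ) (g : Fin N × Fin N → ℝ) : ℝ :=
  ∑ σ : Config N, Real.exp (ham N β g σ)

/-- The free energy `F_N(β) = ln Z_N(β)`. -/
def freeEnergy (N : ℕ) (β : ℝ) (g : Fin N × Fin N → ℝ) : ℝ :=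
  Real.log (partFun N β g)

/-- Two-replica Gibbs average `⟨f⟩` for the single SK system. -/
def gibbs2 (N : ℕ) (β : ℝ) (g : Fin N × Fin N → ℝ)
    (f : Config N → Config N → ℝ) : ℝ :=
  (∑ σ : Config N, ∑ τ : Config N,
    f σ τ * Real.exp (ham N β g σ + ham N β g τ)) / (partFun N β g) ^ 2

/-- Disorder expectation of the two-replica Gibbs average. -/
def Egibbs2 (N : ℕ) (β : ℝ) (f : Config N → Config N → ℝ) : ℝ :=
  ∫ g, gibbs2 N β g f ∂gaussPi N

/-- The interpolated Hamiltonian `√t · H_N + √(1−t) · H'_N`. -/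
def hamT (N : ℕ) (β t : ℝ) (g g' : Fin N × Fin N → ℝ) (σ : Config N) : ℝ :=
  Real.sqrt t * ham N β g σ + Real.sqrt (1 - t) * ham N β g' σ

/-- The coupled Gibbs weight `exp(H¹_{N,t}(σ) + H²_{N,t}(τ))`. -/
def wT (N : ℕ) (β t : ℝ) (g g' g'' : Fin N × Fin N → ℝ)
    (ρ : Config N × Config N) : ℝ :=
  Real.exp (hamT N β t g g' ρ.1 + hamT N β t g g'' ρ.2)

/-- The coupled Gibbs average `⟨f⟩_t` of a function of one pair `(σ, τ)`. -/
def gibbsT (N : ℕ) (β t : ℝ) (g g' g'' : Fin N × Fin N → ℝ)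
    (f : Config N × Config N → ℝ) : ℝ :=
  (∑ ρ : Config N × Config N, f ρ * wT N β t g g' g'' ρ) /
    (∑ ρ : Config N × Config N, wT N β t g g' g'' ρ)

/-- The coupled Gibbs average `⟨f⟩_t` of a function of two pairs. -/
def gibbsT2 (N : ℕ) (β t : ℝ) (g g' g'' : Fin N × Fin N → ℝ)
    (f : Config N × Config N → Config N × Config N → ℝ) : ℝ :=
  (∑ ρ₁ : Config N × Config N, ∑ ρ₂ : Config N × Config N,
    f ρ₁ ρ₂ * wT N β t g g' g'' ρ₁ * wT N β t g g' g'' ρ₂) /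
    (∑ ρ : Config N × Config N, wT N β t g g' g'' ρ) ^ 2

/-- Disorder expectation `E⟨f⟩_t` (one pair). -/
def EgibbsT (N : ℕ) (β t : ℝ) (f : Config N × Config N → ℝ) : ℝ :=
  ∫ ω, gibbsT N β t ω.1 ω.2.1 ω.2.2 f ∂disM3 N

/-- Disorder expectation `E⟨f⟩_t` (two pairs). -/
def EgibbsT2 (N : ℕ) (β t : ℝ)
    (f : Config N × Config N → Config N × Config N → ℝ) : ℝ :=
  ∫ ω, gibbsT2 N β t ω.1 ω.2.1 ω.2.2 f ∂disM3 N

/-- The `s`-dependent cavity field term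
`(β/√N) σ_N ∑_{i<N} (√t g_{iN} + √(1−t) g'_{iN}) σ_i`. -/
def cavField (N : ℕ) (β t : ℝ) (g g' : Fin N × Fin N → ℝ) (σ : Config N) : ℝ :=
  if h : 0 < N then
    (β / Real.sqrt N) * spin (σ ⟨N - 1, Nat.sub_lt h Nat.one_pos⟩) *
      ∑ i ∈ Finset.univ.filter (fun i : Fin N => (i : ℕ) < N - 1),
        (Real.sqrt t * g (i, ⟨N - 1, Nat.sub_lt h Nat.one_pos⟩) +
          Real.sqrt (1 - t) * g' (i, ⟨N - 1, Nat.sub_lt h Nat.one_pos⟩)) * spin (σ i)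
  else 0

/-- The cavity-interpolated Hamiltonian `H^1_{N,t,s}` (resp. `H^2_{N,t,s}` with `g''`). -/
def hamTS (N : ℕ) (β t s : ℝ) (g g' : Fin N × Fin N → ℝ) (σ : Config N) : ℝ :=
  Real.sqrt t * hamCav N β g σ + Real.sqrt (1 - t) * hamCav N β g' σ +
    Real.sqrt s * cavField N β t g g' σ

/-- The coupled cavity Gibbs weight `exp(H¹_{N,t,s}(σ) + H²_{N,t,s}(τ))`. -/
def wTS (N : ℕ) (β t s : ℝ) (g g' g'' : Fin N × Fin N → ℝ)
    (ρ : Config N × Config N) : ℝ :=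
  Real.exp (hamTS N β t s g g' ρ.1 + hamTS N β t s g g'' ρ.2)

/-- The coupled cavity Gibbs average `⟨f⟩_{t,s}` of a function of one pair. -/
def gibbsTS1 (N : ℕ) (β t s : ℝ) (g g' g'' : Fin N × Fin N → ℝ)
    (f : Config N × Config N → ℝ) : ℝ :=
  (∑ ρ : Config N × Config N, f ρ * wTS N β t s g g' g'' ρ) /
    (∑ ρ : Config N × Config N, wTS N β t s g g' g'' ρ)

/-- The coupled cavity Gibbs average `⟨f⟩_{t,s}` of a function of two pairs. -/
def gibbsTS2 (N : ℕ) (β t s : ℝ) (g g' g'' : Fin N × Fin N → ℝ)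
    (f : Config N × Config N → Config N × Config N → ℝ) : ℝ :=
  (∑ ρ₁ : Config N × Config N, ∑ ρ₂ : Config N × Config N,
    f ρ₁ ρ₂ * wTS N β t s g g' g'' ρ₁ * wTS N β t s g g' g'' ρ₂) /
    (∑ ρ : Config N × Config N, wTS N β t s g g' g'' ρ) ^ 2

/-- The coupled cavity Gibbs average `⟨f⟩_{t,s}` of a function of `n` pairs. -/
def gibbsTSn (N : ℕ) (β t s : ℝ) (g g' g'' : Fin N × Fin N → ℝ) {n : ℕ}
    (f : (Fin n → Config N × Config N) → ℝ) : ℝ :=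
  (∑ ρ : Fin n → Config N × Config N, f ρ * ∏ l, wTS N β t s g g' g'' (ρ l)) /
    (∑ ρ₀ : Config N × Config N, wTS N β t s g g' g'' ρ₀) ^ n

/-- Disorder expectation `E⟨f⟩_{t,s}` (one pair). -/
def EgibbsTS1 (N : ℕ) (β t s : ℝ) (f : Config N × Config N → ℝ) : ℝ :=
  ∫ ω, gibbsTS1 N β t s ω.1 ω.2.1 ω.2.2 f ∂disM3 N

/-- Disorder expectation `E⟨f⟩_{t,s}` (two pairs). -/
def EgibbsTS2 (N : ℕ) (β t s : ℝ)
    (f : Config N × Config N → Config N × Config N → ℝ) : ℝ :=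
  ∫ ω, gibbsTS2 N β t s ω.1 ω.2.1 ω.2.2 f ∂disM3 N

/-- Disorder expectation `E⟨f⟩_{t,s}` (`n` pairs). -/
def EgibbsTSn (N : ℕ) (β t s : ℝ) {n : ℕ}
    (f : (Fin n → Config N × Config N) → ℝ) : ℝ :=
  ∫ ω, gibbsTSn N β t s ω.1 ω.2.1 ω.2.2 f ∂disM3 N

/-- The covariance kernel `U(ρ, ρ')` of the `s`-part of the coupled cavity Hamiltonians. -/
def Ufun (N : ℕ) (β t : ℝ) (ρ ρ' : Config N × Config N) : ℝ :=
  β ^ 2 / 2 * (spinLast ρ.1 * spinLast ρ'.1 * ovlpm N ρ.1 ρ'.1 +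
      spinLast ρ.2 * spinLast ρ'.2 * ovlpm N ρ.2 ρ'.2) +
    β ^ 2 * t / 2 * (spinLast ρ.1 * spinLast ρ'.2 * ovlpm N ρ.1 ρ'.2 +
      spinLast ρ.2 * spinLast ρ'.1 * ovlpm N ρ.2 ρ'.1)

/-- `ν(β) = −(1/2)·ln(1 − β²) − β²/2`. -/
def nuSK (b : ℝ) : ℝ := -(1 / 2) * Real.log (1 - b ^ 2) - b ^ 2 / 2

/-- Regrouping two copies of a product measure into a product of two-fold products. -/
theorem measurePreserving_prodProdProdComm {α γ : Type*} [MeasurableSpace α] [MeasurableSpace γ]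
    (μ : Measure α) (ν : Measure γ) [IsProbabilityMeasure μ] [IsProbabilityMeasure ν] :
    MeasurePreserving (fun z : (α × γ) × (α × γ) => ((z.1.1, z.2.1), (z.1.2, z.2.2)))
      ((μ.prod ν).prod (μ.prod ν)) ((μ.prod μ).prod (ν.prod ν)) := by
  have h₁ := measurePreserving_prodAssoc μ ν (μ.prod ν)
  have h₂ := (MeasurePreserving.id μ).prod (measurePreserving_prodAssoc ν μ ν).symm
  have h₃ := (MeasurePreserving.id μ).prod
    ((Measure.measurePreserving_swap (μ := ν) (ν := μ)).prod (MeasurePreserving.id ν))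
  have h₄ := (MeasurePreserving.id μ).prod (measurePreserving_prodAssoc μ ν ν)
  have h₅ := (measurePreserving_prodAssoc μ μ (ν.prod ν)).symm
  exact h₅.comp (h₄.comp (h₃.comp (h₂.comp h₁)))

/-- A product of two mixing maps preserves the product measure. -/
theorem measurePreserving_prod_mix {α γ : Type*} [MeasurableSpace α] [MeasurableSpace γ]
    {μ : Measure α} {ν : Measure γ} [IsProbabilityMeasure μ] [IsProbabilityMeasure ν]
    {φ : α × α → α} {ψ : γ × γ → γ} (hφ : MeasurePreserving φ (μ.prod μ) μ)
    (hψ : MeasurePreserving ψ (ν.prod ν) ν) :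
    MeasurePreserving (fun z : (α × γ) × (α × γ) => (φ (z.1.1, z.2.1), ψ (z.1.2, z.2.2)))
      ((μ.prod ν).prod (μ.prod ν)) (μ.prod ν) :=
  (hφ.prod hψ).comp (measurePreserving_prodProdProdComm μ ν)

/-- A rotation of two independent standard Gaussians is a standard Gaussian. -/
theorem measurePreserving_gaussianReal_mix {a b : ℝ} (h : a ^ 2 + b ^ 2 = 1) :
    MeasurePreserving (fun z : ℝ × ℝ => a * z.1 + b * z.2)
      ((gaussianReal 0 1).prod (gaussianReal 0 1)) (gaussianReal 0 1) := by
  refine ⟨by fun_prop, ?_⟩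
  have h₁ : MeasurePreserving (fun x : ℝ => a * x) (gaussianReal 0 1) _ :=
    ⟨by fun_prop, gaussianReal_map_const_mul a⟩
  have h₂ : MeasurePreserving (fun x : ℝ => b * x) (gaussianReal 0 1) _ :=
    ⟨by fun_prop, gaussianReal_map_const_mul b⟩
  have h₃ := (h₁.prod h₂).map_eq
  have h₄ : (fun z : ℝ × ℝ => a * z.1 + b * z.2) =
      (fun z : ℝ × ℝ => z.1 + z.2) ∘ Prod.map (fun x => a * x) (fun x => b * x) := rfl
  rw [h₄, ← Measure.map_map (by fun_prop) (by fun_prop), h₃]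
  have h₅ := gaussianReal_conv_gaussianReal (m₁ := a * 0) (m₂ := b * 0)
    (v₁ := NNReal.mk (a ^ 2) (sq_nonneg _) * 1) (v₂ := NNReal.mk (b ^ 2) (sq_nonneg _) * 1)
  rw [Measure.conv] at h₅
  rw [h₅]
  congr 1
  · simp
  · apply NNReal.eq
    simpa using h

/-- The coordinatewise mixture `a · g + b · h` of two disorders. -/
def mixDisorder {N : ℕ} (a b : Fin N × Fin N → ℝ)
    (z : (Fin N × Fin N → ℝ) × (Fin N × Fin N → ℝ)) : Fin N × Fin N → ℝ :=
  fun p => a p * z.1 p + b p * z.2 p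

theorem measurePreserving_mixDisorder {N : ℕ} {a b : Fin N × Fin N → ℝ}
    (h : ∀ p, a p ^ 2 + b p ^ 2 = 1) :
    MeasurePreserving (mixDisorder a b) ((gaussPi N).prod (gaussPi N)) (gaussPi N) :=
  (measurePreserving_pi _ _ fun p => measurePreserving_gaussianReal_mix (h p)).comp
    (measurePreserving_arrowProdEquivProdArrow ℝ ℝ (Fin N × Fin N)
      (fun _ => gaussianReal 0 1) (fun _ => gaussianReal 0 1)).symm

theorem integrable_eval_gaussPi {N : ℕ} (p : Fin N × Fin N) :
    Integrable (fun g : Fin N × Fin N → ℝ => g p) (gaussPi N) :=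
  (measurePreserving_eval (fun _ : Fin N × Fin N => gaussianReal 0 1)
    p).integrable_comp_of_integrable (memLp_one_iff_integrable.1 (memLp_id_gaussianReal 1))

theorem integrable_sum_gaussPi {N : ℕ} (c : Fin N × Fin N → ℝ) :
    Integrable (fun g : Fin N × Fin N → ℝ => ∑ p, c p * g p) (gaussPi N) :=
  integrable_finsetSum _ fun p _ => (integrable_eval_gaussPi p).const_mul _

theorem integral_sum_gaussPi {N : ℕ} (c : Fin N × Fin N → ℝ) :
    ∫ g, ∑ p, c p * g p ∂gaussPi N = 0 := by
  rw [integral_finsetSum _ fun p _ => (integrable_eval_gaussPi p).const_mul _]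
  refine Finset.sum_eq_zero fun p _ => ?_
  rw [integral_const_mul]
  have h := integral_comp_eval (μ := fun _ : Fin N × Fin N => gaussianReal 0 1) (i := p)
    (f := fun x : ℝ => x) (by fun_prop)
  rw [integral_id_gaussianReal] at h
  rw [gaussPi, h, mul_zero]

theorem integrable_exp_sum_gaussPi {N : ℕ} (c : Fin N × Fin N → ℝ) :
    Integrable (fun g : Fin N × Fin N → ℝ => Real.exp (∑ p, c p * g p)) (gaussPi N) := by
  simp_rw [Real.exp_sum]
  exact Integrable.fintype_prod fun p => integrable_exp_mul_gaussianReal (c p)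

theorem integral_exp_sum_gaussPi {N : ℕ} (c : Fin N × Fin N → ℝ) :
    ∫ g, Real.exp (∑ p, c p * g p) ∂gaussPi N = Real.exp ((∑ p, c p ^ 2) / 2) := by
  simp_rw [Real.exp_sum]
  rw [gaussPi, integral_fintype_prod_eq_prod (fun p x => Real.exp (c p * x)), Finset.sum_div,
    Real.exp_sum]
  refine Finset.prod_congr rfl fun p _ => ?_
  have h := mgf_gaussianReal (p := gaussianReal 0 1) (X := id) (μ := 0) (v := 1) (by simp) (c p)
  simpa [mgf] using h

/-- The average of `f` over `n` independent replicas weighted by `w`. -/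
def weightedAverage {ι : Type*} [Fintype ι] {n : ℕ} (f : (Fin n → ι) → ℝ) (w : ι → ℝ) : ℝ :=
  (∑ ρ : Fin n → ι, f ρ * ∏ l, w (ρ l)) / (∑ i, w i) ^ n

theorem weightedAverage_eq_sum {ι : Type*} [Fintype ι] {n : ℕ} (f : (Fin n → ι) → ℝ)
    (w : ι → ℝ) :
    weightedAverage f w = ∑ ρ : Fin n → ι, f ρ * ((∏ l, w (ρ l)) / (∑ i, w i) ^ n) := by
  simp only [weightedAverage, Finset.sum_div, mul_div_assoc]

theorem weightedAverage_nonneg {ι : Type*} [Fintype ι] {n : ℕ} {f : (Fin n → ι) → ℝ}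
    (hf : ∀ ρ, 0 ≤ f ρ) {w : ι → ℝ} (hw : ∀ i, 0 < w i) : 0 ≤ weightedAverage f w :=
  div_nonneg
    (Finset.sum_nonneg fun ρ _ => mul_nonneg (hf ρ) (Finset.prod_nonneg fun _ _ => (hw _).le))
    (pow_nonneg (Finset.sum_nonneg fun i _ => (hw i).le) n)

theorem prod_div_sum_pow_le_one {ι : Type*} [Fintype ι] {n : ℕ}
    {w : ι → ℝ} (hw : ∀ i, 0 < w i) (ρ : Fin n → ι) :
    (∏ l, w (ρ l)) / (∑ i, w i) ^ n ≤ 1 := by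
  refine div_le_one_of_le₀ ?_ (pow_nonneg (Finset.sum_nonneg fun i _ => (hw i).le) n)
  calc ∏ l, w (ρ l) ≤ ∏ _l : Fin n, ∑ i, w i :=
        Finset.prod_le_prod (fun l _ => (hw _).le) fun l _ =>
          Finset.single_le_sum (fun i _ => (hw i).le) (Finset.mem_univ (ρ l))
    _ = (∑ i, w i) ^ n := by simp

theorem weightedAverage_le {ι : Type*} [Fintype ι] {n : ℕ} {f : (Fin n → ι) → ℝ}
    (hf : ∀ ρ, 0 ≤ f ρ) {w : ι → ℝ} (hw : ∀ i, 0 < w i) : weightedAverage f w ≤ ∑ ρ, f ρ := by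
  rw [weightedAverage_eq_sum]
  exact Finset.sum_le_sum fun ρ _ => mul_le_of_le_one_right (hf ρ) (prod_div_sum_pow_le_one hw ρ)

theorem integrable_weightedAverage {ι Ω : Type*} [Fintype ι] [MeasurableSpace Ω]
    {μ : Measure Ω} [IsProbabilityMeasure μ] {n : ℕ} {f : (Fin n → ι) → ℝ}
    (hf : ∀ ρ, 0 ≤ f ρ) {w : Ω → ι → ℝ} (hw : ∀ ω i, 0 < w ω i)
    (hm : ∀ i, Measurable fun ω => w ω i) :
    Integrable (fun ω => weightedAverage f (w ω)) μ := by
  refine Integrable.of_bound (C := ∑ ρ, f ρ) ?_ (ae_of_all _ fun ω => ?_)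
  · unfold weightedAverage
    exact Measurable.aestronglyMeasurable (by fun_prop)
  · rw [Real.norm_of_nonneg (weightedAverage_nonneg hf (hw ω))]
    exact weightedAverage_le hf (hw ω)

/-- The tangent-line inequality behind the comparison:
`e^a z⁻ⁿ ≥ c⁻ⁿ (1 + a - n (z / c - 1))` for positive `z` and `c`. -/
theorem tangent_le_exp_div_pow {z c : ℝ} (hz : 0 < z) (hc : 0 < c) (a : ℝ) (n : ℕ) :
    (1 + a - n * (z / c - 1)) / c ^ n ≤ Real.exp a / z ^ n := by
  have h₁ : Real.log (z / c) ≤ z / c - 1 := Real.log_le_sub_one_of_pos (by positivity)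
  have h₂ : (n : ℝ) * Real.log (z / c) ≤ n * (z / c - 1) :=
    mul_le_mul_of_nonneg_left h₁ n.cast_nonneg
  have h₃ := Real.add_one_le_exp (a - n * Real.log (z / c))
  have h₄ : Real.exp (a - n * Real.log (z / c)) = Real.exp a / (z / c) ^ n := by
    rw [Real.exp_sub, mul_comm, Real.exp_mul, Real.exp_log (by positivity), Real.rpow_natCast]
  rw [h₄, div_pow, div_div_eq_mul_div] at h₃
  rw [div_le_iff₀ (by positivity), div_mul_eq_mul_div]
  linarith

/-- Tilting positive weights by centred fields with exponential moments at most `K` decreases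
the expected average of a nonnegative function of `n` replicas by at most the factor `Kⁿ`. -/
theorem weightedAverage_le_integral_tilt {ι Ω : Type*} [Fintype ι] [Nonempty ι]
    [MeasurableSpace Ω] {μ : Measure Ω} [IsProbabilityMeasure μ] {n : ℕ} {f : (Fin n → ι) → ℝ}
    (hf : ∀ ρ, 0 ≤ f ρ) {w : ι → ℝ} (hw : ∀ i, 0 < w i) {Y : ι → Ω → ℝ}
    (hm : ∀ i, Measurable (Y i)) (hY : ∀ i, Integrable (Y i) μ) (hY₀ : ∀ i, ∫ ω, Y i ω ∂μ = 0)
    (he : ∀ i, Integrable (fun ω => Real.exp (Y i ω)) μ) {K : ℝ} (hK : 0 < K)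
    (heK : ∀ i, ∫ ω, Real.exp (Y i ω) ∂μ ≤ K) :
    weightedAverage f w ≤ K ^ n * ∫ ω, weightedAverage f (fun i => w i * Real.exp (Y i ω)) ∂μ := by
  have hS : 0 < ∑ i, w i := Finset.sum_pos (fun i _ => hw i) Finset.univ_nonempty
  set c : ℝ := K * ∑ i, w i with hc_def
  have hc : 0 < c := mul_pos hK hS
  have hZ : Integrable (fun ω => ∑ i, w i * Real.exp (Y i ω)) μ :=
    integrable_finsetSum _ fun i _ => (he i).const_mul _
  have hA : ∀ ρ : Fin n → ι, Integrable (fun ω => ∑ l, Y (ρ l) ω) μ := fun ρ =>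
    integrable_finsetSum _ fun l _ => hY (ρ l)
  have hEZ : ∫ ω, ∑ i, w i * Real.exp (Y i ω) ∂μ ≤ c := by
    rw [integral_finsetSum _ fun i _ => (he i).const_mul _, hc_def, Finset.mul_sum]
    refine Finset.sum_le_sum fun i _ => ?_
    rw [integral_const_mul, mul_comm K]
    exact mul_le_mul_of_nonneg_left (heK i) (hw i).le
  have hEA : ∀ ρ : Fin n → ι, ∫ ω, ∑ l, Y (ρ l) ω ∂μ = 0 := fun ρ => by
    rw [integral_finsetSum _ fun l _ => hY (ρ l)]
    exact Finset.sum_eq_zero fun l _ => hY₀ _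
  have hpos : ∀ ω i, 0 < w i * Real.exp (Y i ω) := fun ω i => mul_pos (hw i) (Real.exp_pos _)
  set T : (Fin n → ι) → Ω → ℝ := fun ρ ω =>
    1 + ∑ l, Y (ρ l) ω - n * ((∑ i, w i * Real.exp (Y i ω)) / c - 1) with hT_def
  have hA₁ : ∀ ρ : Fin n → ι, Integrable (fun ω => 1 + ∑ l, Y (ρ l) ω) μ := fun ρ =>
    (integrable_const 1).add (hA ρ)
  have hZ₁ : Integrable (fun ω => (n : ℝ) * ((∑ i, w i * Real.exp (Y i ω)) / c - 1)) μ :=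
    ((hZ.div_const c).sub (integrable_const 1)).const_mul _
  have hT : ∀ ρ, Integrable (T ρ) μ := fun ρ => (hA₁ ρ).sub hZ₁
  have hET : ∀ ρ, 1 ≤ ∫ ω, T ρ ω ∂μ := fun ρ => by
    have h₁ : ∫ ω, T ρ ω ∂μ = 1 - n * ((∫ ω, ∑ i, w i * Real.exp (Y i ω) ∂μ) / c - 1) := by
      rw [hT_def]
      simp only
      rw [integral_sub (hA₁ ρ) hZ₁, integral_add (integrable_const 1) (hA ρ), hEA,
        integral_const_mul,
        integral_sub (hZ.div_const c) (integrable_const 1), integral_div]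
      simp
    have h₂ : (∫ ω, ∑ i, w i * Real.exp (Y i ω) ∂μ) / c ≤ 1 := (div_le_one hc).2 hEZ
    have h₃ : (n : ℝ) * ((∫ ω, ∑ i, w i * Real.exp (Y i ω) ∂μ) / c - 1) ≤ 0 :=
      mul_nonpos_of_nonneg_of_nonpos n.cast_nonneg (by linarith)
    linarith
  have hG : Integrable (fun ω => ∑ ρ : Fin n → ι, f ρ * ((∏ l, w (ρ l)) * (T ρ ω / c ^ n))) μ :=
    integrable_finsetSum _ fun ρ _ => (((hT ρ).div_const _).const_mul _).const_mul _
  have hle : ∫ ω, ∑ ρ : Fin n → ι, f ρ * ((∏ l, w (ρ l)) * (T ρ ω / c ^ n)) ∂μ ≤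
      ∫ ω, weightedAverage f (fun i => w i * Real.exp (Y i ω)) ∂μ := by
    refine integral_mono hG (integrable_weightedAverage hf hpos fun i => by fun_prop) fun ω => ?_
    rw [weightedAverage_eq_sum]
    refine Finset.sum_le_sum fun ρ _ => mul_le_mul_of_nonneg_left ?_ (hf ρ)
    rw [Finset.prod_mul_distrib, ← Real.exp_sum, mul_div_assoc]
    exact mul_le_mul_of_nonneg_left
      (tangent_le_exp_div_pow (Finset.sum_pos (fun i _ => hpos ω i) Finset.univ_nonempty) hc _ n)
      (Finset.prod_nonneg fun l _ => (hw _).le)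
  calc weightedAverage f w
      = K ^ n * ∑ ρ : Fin n → ι, f ρ * ((∏ l, w (ρ l)) * (1 / c ^ n)) := by
        rw [weightedAverage_eq_sum, Finset.mul_sum]
        refine Finset.sum_congr rfl fun ρ _ => ?_
        rw [hc_def, mul_pow]
        field_simp
    _ ≤ K ^ n * ∫ ω, ∑ ρ : Fin n → ι, f ρ * ((∏ l, w (ρ l)) * (T ρ ω / c ^ n)) ∂μ := by
        rw [integral_finsetSum _ fun ρ _ => (((hT ρ).div_const _).const_mul _).const_mul _]
        refine mul_le_mul_of_nonneg_left (Finset.sum_le_sum fun ρ _ => ?_) (by positivity)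
        rw [integral_const_mul, integral_const_mul, integral_div]
        refine mul_le_mul_of_nonneg_left (mul_le_mul_of_nonneg_left ?_
          (Finset.prod_nonneg fun l _ => (hw _).le)) (hf ρ)
        exact div_le_div_of_nonneg_right (hET ρ) (by positivity)
    _ ≤ _ := mul_le_mul_of_nonneg_left hle (by positivity)

/-- A linear form in the three independent disorders. -/
def disorderForm {N : ℕ} (c c' c'' : Fin N × Fin N → ℝ)
    (ω : (Fin N × Fin N → ℝ) × (Fin N × Fin N → ℝ) × (Fin N × Fin N → ℝ)) : ℝ :=
  ∑ p, c p * ω.1 p + (∑ p, c' p * ω.2.1 p + ∑ p, c'' p * ω.2.2 p)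

instance (N : ℕ) : IsProbabilityMeasure (disM3 N) := by
  unfold disM3; infer_instance

theorem integrable_disorderForm {N : ℕ} (c c' c'' : Fin N × Fin N → ℝ) :
    Integrable (disorderForm c c' c'') (disM3 N) :=
  ((integrable_sum_gaussPi c).comp_fst _).add
    ((((integrable_sum_gaussPi c').comp_fst _).add
      ((integrable_sum_gaussPi c'').comp_snd _)).comp_snd _)

theorem integral_disorderForm {N : ℕ} (c c' c'' : Fin N × Fin N → ℝ) :
    ∫ ω, disorderForm c c' c'' ω ∂disM3 N = 0 := by
  have h' := (integrable_sum_gaussPi c').comp_fst (gaussPi N)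
  have h'' := (integrable_sum_gaussPi c'').comp_snd (gaussPi N)
  have h : Integrable (fun z : (Fin N × Fin N → ℝ) × (Fin N × Fin N → ℝ) =>
      ∑ p, c' p * z.1 p + ∑ p, c'' p * z.2 p) ((gaussPi N).prod (gaussPi N)) := h'.add h''
  unfold disorderForm disM3
  rw [integral_add ((integrable_sum_gaussPi c).comp_fst _) (h.comp_snd _),
    integral_fun_fst (fun g : Fin N × Fin N → ℝ => ∑ p, c p * g p),
    integral_fun_snd (fun z : (Fin N × Fin N → ℝ) × (Fin N × Fin N → ℝ) =>
      ∑ p, c' p * z.1 p + ∑ p, c'' p * z.2 p),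
    integral_add h' h'', integral_fun_fst (fun g : Fin N × Fin N → ℝ => ∑ p, c' p * g p),
    integral_fun_snd (fun g : Fin N × Fin N → ℝ => ∑ p, c'' p * g p)]
  simp [integral_sum_gaussPi]

theorem integrable_exp_disorderForm {N : ℕ} (c c' c'' : Fin N × Fin N → ℝ) :
    Integrable (fun ω => Real.exp (disorderForm c c' c'' ω)) (disM3 N) := by
  unfold disorderForm
  simp_rw [Real.exp_add]
  exact (integrable_exp_sum_gaussPi c).mul_prod
    ((integrable_exp_sum_gaussPi c').mul_prod (integrable_exp_sum_gaussPi c''))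

theorem integral_exp_disorderForm {N : ℕ} (c c' c'' : Fin N × Fin N → ℝ) :
    ∫ ω, Real.exp (disorderForm c c' c'' ω) ∂disM3 N =
      Real.exp ((∑ p, c p ^ 2 + (∑ p, c' p ^ 2 + ∑ p, c'' p ^ 2)) / 2) := by
  unfold disorderForm disM3
  simp_rw [Real.exp_add]
  rw [integral_prod_mul (fun g : Fin N × Fin N → ℝ => Real.exp (∑ p, c p * g p))
      (fun z : (Fin N × Fin N → ℝ) × (Fin N × Fin N → ℝ) =>
        Real.exp (∑ p, c' p * z.1 p) * Real.exp (∑ p, c'' p * z.2 p)),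
    integral_prod_mul (fun g : Fin N × Fin N → ℝ => Real.exp (∑ p, c' p * g p))
      (fun g : Fin N × Fin N → ℝ => Real.exp (∑ p, c'' p * g p)),
    integral_exp_sum_gaussPi, integral_exp_sum_gaussPi, integral_exp_sum_gaussPi,
    ← Real.exp_add, ← Real.exp_add]
  congr 1
  ring

theorem measurable_disorderForm {N : ℕ} (c c' c'' : Fin N × Fin N → ℝ) :
    Measurable (disorderForm c c' c'') := by
  unfold disorderForm
  fun_prop

/-- The coefficient of `g_p` in the cavity field of `σ` (before the `t`-weights). -/
def cavCoeff (N : ℕ) (β : ℝ) (σ : Config N) (p : Fin N × Fin N) : ℝ :=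
  if (p.2 : ℕ) = N - 1 ∧ (p.1 : ℕ) < N - 1 then
    β / Real.sqrt N * spin (σ p.2) * spin (σ p.1) else 0

theorem spin_sq (b : Bool) : spin b ^ 2 = 1 := by
  cases b <;> simp [spin]

theorem sum_eq_sum_last {N : ℕ} (hN : 0 < N) (F : Fin N × Fin N → ℝ)
    (hF : ∀ p, (p.2 : ℕ) ≠ N - 1 → F p = 0) :
    ∑ p, F p = ∑ i, F (i, ⟨N - 1, Nat.sub_lt hN Nat.one_pos⟩) := by
  rw [Fintype.sum_prod_type]
  refine Finset.sum_congr rfl fun i _ => ?_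
  refine Finset.sum_eq_single _ (fun j _ hj => hF _ fun h => hj (Fin.ext h)) (by simp)

theorem sum_cavCoeff_sq_le {N : ℕ} (hN : 0 < N) (β : ℝ) (σ : Config N) :
    ∑ p, cavCoeff N β σ p ^ 2 ≤ β ^ 2 := by
  have hN' : (0 : ℝ) < N := Nat.cast_pos.2 hN
  rw [sum_eq_sum_last hN _ fun p hp => by simp [cavCoeff, hp]]
  calc ∑ i, cavCoeff N β σ (i, ⟨N - 1, Nat.sub_lt hN Nat.one_pos⟩) ^ 2
      ≤ ∑ _i : Fin N, β ^ 2 / N := by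
        refine Finset.sum_le_sum fun i _ => ?_
        unfold cavCoeff
        split_ifs
        · rw [mul_pow, mul_pow, spin_sq, spin_sq, div_pow, Real.sq_sqrt hN'.le]
          simp
        · simp only [ne_eq, OfNat.ofNat_ne_zero, not_false_eq_true, zero_pow]
          positivity
    _ = β ^ 2 := by
        rw [Finset.sum_const, Finset.card_univ, Fintype.card_fin, nsmul_eq_mul]
        field_simp

theorem cavField_eq_sum {N : ℕ} (hN : 0 < N) (β t : ℝ) (g g' : Fin N × Fin N → ℝ)
    (σ : Config N) :
    cavField N β t g g' σ =
      ∑ p, cavCoeff N β σ p * (Real.sqrt t * g p + Real.sqrt (1 - t) * g' p) := by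
  rw [sum_eq_sum_last hN _ fun p hp => by simp [cavCoeff, hp], cavField, dif_pos hN,
    Finset.sum_filter, Finset.mul_sum]
  refine Finset.sum_congr rfl fun i _ => ?_
  by_cases h : (i : ℕ) < N - 1
  · simp only [cavCoeff, h, if_true, and_self]
    ring
  · simp [cavCoeff, h]

/-- The total cavity field acting on a pair of configurations. -/
def cavPair (N : ℕ) (β t : ℝ)
    (ω : (Fin N × Fin N → ℝ) × (Fin N × Fin N → ℝ) × (Fin N × Fin N → ℝ))
    (ρ : Config N × Config N) : ℝ :=
  cavField N β t ω.1 ω.2.1 ρ.1 + cavField N β t ω.1 ω.2.2 ρ.2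

theorem mul_cavPair_eq_disorderForm {N : ℕ} (hN : 0 < N) (β t r : ℝ)
    (ω : (Fin N × Fin N → ℝ) × (Fin N × Fin N → ℝ) × (Fin N × Fin N → ℝ))
    (ρ : Config N × Config N) :
    r * cavPair N β t ω ρ =
      disorderForm (fun p => r * Real.sqrt t * (cavCoeff N β ρ.1 p + cavCoeff N β ρ.2 p))
        (fun p => r * Real.sqrt (1 - t) * cavCoeff N β ρ.1 p)
        (fun p => r * Real.sqrt (1 - t) * cavCoeff N β ρ.2 p) ω := by
  simp only [cavPair, cavField_eq_sum hN, disorderForm, Finset.mul_sum,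
    ← Finset.sum_add_distrib]
  exact Finset.sum_congr rfl fun p _ => by ring

theorem cavPair_variance_le {N : ℕ} (hN : 0 < N) (β : ℝ) {t r : ℝ} (ht : t ∈ Set.Icc (0 : ℝ) 1)
    (hr : r ^ 2 ≤ 1) (ρ : Config N × Config N) :
    (∑ p, (r * Real.sqrt t * (cavCoeff N β ρ.1 p + cavCoeff N β ρ.2 p)) ^ 2 +
      (∑ p, (r * Real.sqrt (1 - t) * cavCoeff N β ρ.1 p) ^ 2 +
        ∑ p, (r * Real.sqrt (1 - t) * cavCoeff N β ρ.2 p) ^ 2)) / 2 ≤ β ^ 2 * (1 + t) := by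
  have h₁ := sum_cavCoeff_sq_le hN β ρ.1
  have h₂ := sum_cavCoeff_sq_le hN β ρ.2
  have h₃ : ∑ p, (cavCoeff N β ρ.1 p + cavCoeff N β ρ.2 p) ^ 2 ≤ 4 * β ^ 2 :=
    calc ∑ p, (cavCoeff N β ρ.1 p + cavCoeff N β ρ.2 p) ^ 2
        ≤ ∑ p, (2 * cavCoeff N β ρ.1 p ^ 2 + 2 * cavCoeff N β ρ.2 p ^ 2) :=
          Finset.sum_le_sum fun p _ => by
            nlinarith [sq_nonneg (cavCoeff N β ρ.1 p - cavCoeff N β ρ.2 p)]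
      _ ≤ 4 * β ^ 2 := by
          rw [Finset.sum_add_distrib, ← Finset.mul_sum, ← Finset.mul_sum]
          linarith
  have ht₁ : 0 ≤ 1 - t := by linarith [ht.2]
  simp_rw [mul_pow, Real.sq_sqrt ht.1, Real.sq_sqrt ht₁, ← Finset.mul_sum]
  have h₄ := mul_le_mul_of_nonneg_left h₃ ht.1
  have h₅ := mul_le_mul_of_nonneg_left (add_le_add h₁ h₂) ht₁
  have h₆ : r ^ 2 * (β ^ 2 * (1 + t)) ≤ β ^ 2 * (1 + t) :=
    mul_le_of_le_one_left (mul_nonneg (sq_nonneg _) (by linarith [ht.1])) hr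
  nlinarith [mul_le_mul_of_nonneg_left (add_le_add h₄ h₅) (sq_nonneg r)]

/-- Weights that damp the entries of the last column by `x` and the others by `y`. -/
def columnWeight (N : ℕ) (x y : ℝ) (p : Fin N × Fin N) : ℝ :=
  if (p.2 : ℕ) = N - 1 then x else y

theorem hamCav_mixDisorder {N : ℕ} (β x x' : ℝ) (g h : Fin N × Fin N → ℝ) (σ : Config N) :
    hamCav N β (mixDisorder (columnWeight N x 1) (columnWeight N x' 0) (g, h)) σ =
      hamCav N β g σ := by
  unfold hamCav
  congr 1
  refine Finset.sum_congr rfl fun p hp => ?_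
  have hp' : (p.2 : ℕ) ≠ N - 1 := ((Finset.mem_filter.1 hp).2.2).ne
  simp [mixDisorder, columnWeight, hp']

theorem cavField_mixDisorder {N : ℕ} (hN : 0 < N) (β t x x' : ℝ)
    (g h g' h' : Fin N × Fin N → ℝ) (σ : Config N) :
    cavField N β t (mixDisorder (columnWeight N x 1) (columnWeight N x' 0) (g, h))
        (mixDisorder (columnWeight N x 1) (columnWeight N x' 0) (g', h')) σ =
      x * cavField N β t g g' σ + x' * cavField N β t h h' σ := by
  simp only [cavField_eq_sum hN, Finset.mul_sum, ← Finset.sum_add_distrib]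
  refine Finset.sum_congr rfl fun p _ => ?_
  by_cases hp : (p.2 : ℕ) = N - 1
  · simp only [mixDisorder, columnWeight, hp, if_true]
    ring
  · simp [cavCoeff, hp]

/-- Mixing two triples of disorders in the last column. -/
def mixTriple (N : ℕ) (s : ℝ)
    (z : ((Fin N × Fin N → ℝ) × (Fin N × Fin N → ℝ) × (Fin N × Fin N → ℝ)) ×
      ((Fin N × Fin N → ℝ) × (Fin N × Fin N → ℝ) × (Fin N × Fin N → ℝ))) :
    (Fin N × Fin N → ℝ) × (Fin N × Fin N → ℝ) × (Fin N × Fin N → ℝ) :=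
  let T := mixDisorder (columnWeight N (Real.sqrt s) 1) (columnWeight N (Real.sqrt (1 - s)) 0)
  (T (z.1.1, z.2.1), T (z.1.2.1, z.2.2.1), T (z.1.2.2, z.2.2.2))

theorem measurePreserving_mixTriple (N : ℕ) {s : ℝ} (hs : s ∈ Set.Icc (0 : ℝ) 1) :
    MeasurePreserving (mixTriple N s) ((disM3 N).prod (disM3 N)) (disM3 N) := by
  have h : MeasurePreserving (mixDisorder (columnWeight N (Real.sqrt s) 1)
      (columnWeight N (Real.sqrt (1 - s)) 0)) ((gaussPi N).prod (gaussPi N)) (gaussPi N) := by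
    refine measurePreserving_mixDisorder fun p => ?_
    unfold columnWeight
    split_ifs
    · rw [Real.sq_sqrt hs.1, Real.sq_sqrt (by linarith [hs.2])]
      ring
    · norm_num
  exact measurePreserving_prod_mix h (measurePreserving_prod_mix h h)

theorem wTS_mixTriple {N : ℕ} (hN : 0 < N) (β t s : ℝ)
    (z : ((Fin N × Fin N → ℝ) × (Fin N × Fin N → ℝ) × (Fin N × Fin N → ℝ)) ×
      ((Fin N × Fin N → ℝ) × (Fin N × Fin N → ℝ) × (Fin N × Fin N → ℝ)))
    (ρ : Config N × Config N) :
    wTS N β t 1 (mixTriple N s z).1 (mixTriple N s z).2.1 (mixTriple N s z).2.2 ρ =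
      wTS N β t s z.1.1 z.1.2.1 z.1.2.2 ρ *
        Real.exp (Real.sqrt (1 - s) * cavPair N β t z.2 ρ) := by
  simp only [wTS, mixTriple, hamTS, hamCav_mixDisorder, cavField_mixDisorder hN, cavPair,
    Real.sqrt_one, ← Real.exp_add]
  congr 1
  ring

theorem measurable_wTS (N : ℕ) (β t s : ℝ) (ρ : Config N × Config N) :
    Measurable fun ω : (Fin N × Fin N → ℝ) × (Fin N × Fin N → ℝ) × (Fin N × Fin N → ℝ) =>
      wTS N β t s ω.1 ω.2.1 ω.2.2 ρ := by
  rcases Nat.eq_zero_or_pos N with rfl | hN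
  · unfold wTS hamTS hamCav cavField
    simp
  · simp only [wTS, hamTS, hamCav, cavField_eq_sum hN]
    fun_prop

theorem integrable_gibbsTSn (N : ℕ) (β t s : ℝ) {n : ℕ}
    {f : (Fin n → Config N × Config N) → ℝ} (hf : ∀ ρ, 0 ≤ f ρ) :
    Integrable (fun ω => gibbsTSn N β t s ω.1 ω.2.1 ω.2.2 f) (disM3 N) :=
  integrable_weightedAverage hf (fun _ _ => Real.exp_pos _) (measurable_wTS N β t s)

/-- Comparison with the sharper constant `exp(n β² (1 + t))`. -/
theorem EgibbsTSn_le_exp_mul {N : ℕ} (hN : 0 < N) (β : ℝ) {n : ℕ}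
    {f : (Fin n → Config N × Config N) → ℝ} (hf : ∀ ρ, 0 ≤ f ρ)
    {t : ℝ} (ht : t ∈ Set.Icc (0 : ℝ) 1) {s : ℝ} (hs : s ∈ Set.Icc (0 : ℝ) 1) :
    EgibbsTSn N β t s f ≤ Real.exp (n * (β ^ 2 * (1 + t))) * EgibbsTSn N β t 1 f := by
  have hmp := measurePreserving_mixTriple N hs
  have hint := integrable_gibbsTSn N β t 1 hf
  have hcomp : Integrable (fun z => gibbsTSn N β t 1 (mixTriple N s z).1
      (mixTriple N s z).2.1 (mixTriple N s z).2.2 f) ((disM3 N).prod (disM3 N)) :=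
    hmp.integrable_comp_of_integrable hint
  have hE : EgibbsTSn N β t 1 f = ∫ x, ∫ y, gibbsTSn N β t 1 (mixTriple N s (x, y)).1
      (mixTriple N s (x, y)).2.1 (mixTriple N s (x, y)).2.2 f ∂disM3 N ∂disM3 N := by
    rw [← integral_prod _ hcomp, EgibbsTSn]
    conv_lhs => rw [← hmp.map_eq]
    refine integral_map hmp.measurable.aemeasurable ?_
    rw [hmp.map_eq]
    exact hint.aestronglyMeasurable
  rw [hE, ← integral_const_mul, EgibbsTSn]
  refine integral_mono (integrable_gibbsTSn N β t s hf) (hcomp.integral_prod_left.const_mul _)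
    fun x => ?_
  have hr : Real.sqrt (1 - s) ^ 2 ≤ 1 := by
    rw [Real.sq_sqrt (by linarith [hs.2])]
    linarith [hs.1]
  have hY := fun ρ : Config N × Config N =>
    funext fun ω => mul_cavPair_eq_disorderForm hN β t (Real.sqrt (1 - s)) ω ρ
  have key := weightedAverage_le_integral_tilt (μ := disM3 N) hf
    (w := wTS N β t s x.1 x.2.1 x.2.2) (fun _ => Real.exp_pos _)
    (Y := fun ρ ω => Real.sqrt (1 - s) * cavPair N β t ω ρ)
    (fun ρ => by rw [hY]; exact measurable_disorderForm _ _ _)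
    (fun ρ => by rw [hY]; exact integrable_disorderForm _ _ _)
    (fun ρ => by simp_rw [mul_cavPair_eq_disorderForm hN]; exact integral_disorderForm _ _ _)
    (fun ρ => by
      simp_rw [mul_cavPair_eq_disorderForm hN]; exact integrable_exp_disorderForm _ _ _)
    (Real.exp_pos (β ^ 2 * (1 + t)))
    (fun ρ => by
      simp_rw [mul_cavPair_eq_disorderForm hN]
      rw [integral_exp_disorderForm]
      exact Real.exp_le_exp.2 (cavPair_variance_le hN β ht hr ρ))
  rw [← Real.exp_nat_mul] at key
  simp_rw [← wTS_mixTriple hN β t s (x, _)] at key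
  exact key

/-- comparison of the coupled cavity Gibbs average at `s` with the full
system (`s = 1`): `E⟨f⟩_{t,s} ≤ exp(2(2n²+1)β²(1+t))·E⟨f⟩_{t,1}` for `f ≥ 0`. -/
theorem sk_cavity_comparison (N : ℕ) (hN : 1 ≤ N) (β : ℝ) (hβ : β ∈ Set.Ioc (0 : ℝ) 1)
    (n : ℕ) (f : (Fin n → Config N × Config N) → ℝ) (hf : ∀ ρ, 0 ≤ f ρ)
    (t : ℝ) (ht : t ∈ Set.Icc (0 : ℝ) 1) (s : ℝ) (hs : s ∈ Set.Icc (0 : ℝ) 1) :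
    EgibbsTSn N β t s f ≤
      Real.exp (2 * (2 * (n : ℝ) ^ 2 + 1) * β ^ 2 * (1 + t)) * EgibbsTSn N β t 1 f := by
  refine (EgibbsTSn_le_exp_mul hN β hf ht hs).trans ?_
  have hE : 0 ≤ EgibbsTSn N β t 1 f :=
    integral_nonneg fun ω => weightedAverage_nonneg hf fun _ => Real.exp_pos _
  refine mul_le_mul_of_nonneg_right (Real.exp_le_exp.2 ?_) hE
  have hb : 0 ≤ β ^ 2 * (1 + t) := mul_nonneg (sq_nonneg _) (by linarith [ht.1])
  have hn : (n : ℝ) ≤ 2 * (2 * (n : ℝ) ^ 2 + 1) := by nlinarith [sq_nonneg ((n : ℝ) - 1)]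
  calc (n : ℝ) * (β ^ 2 * (1 + t)) ≤ 2 * (2 * (n : ℝ) ^ 2 + 1) * (β ^ 2 * (1 + t)) :=
        mul_le_mul_of_nonneg_right hn hb
    _ = 2 * (2 * (n : ℝ) ^ 2 + 1) * β ^ 2 * (1 + t) := by ring

end
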